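/- Let p<1 be real (so that 1−p is not a nonpositive integer) and let q, α be complex. Then the function F(x) = (x/(1−x))^p · ϑ_α^{(−p,q)}(x) is twice differentiable on (0,1) and satisfies (D_{p,q} F)(x) = (α² − (1+p+q)²/4)·F(x) for all 0<x<1; that is, for p≠0 it provides a second family of eigenfunctions of the Jacobi operator D_{p,q} with the same eigenvalue as ϑ_α^{(p,q)}. -/

import Mathlib

open scoped Real
open Complex MeasureTheory Set ComplexConjugate

noncomputable section

/-- Pochhammer symbol `(a)ₙ = a (a+1) ⋯ (a+n−1)`. -/
def poch (a : ℂ) (n : ℕ) : ℂ := (ascPochhammer ℂ n).eval a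

/-- Gauss hypergeometric series `₂F₁(a,b;c;z)`. -/
def hyp2F1 (a b c z : ℂ) : ℂ :=
  ∑' n : ℕ, poch a n * poch b n / (poch c n * (n.factorial : ℂ)) * z ^ n

/-- Jacobi function `ϑ_α^{(p,q)}(x)` on `0 < x < 1`. -/
def thetaJ (p q α : ℂ) (x : ℝ) : ℂ :=
  (x : ℂ) ^ ((1 + p + q) / 2 + α) *
    hyp2F1 ((1 + p + q) / 2 + α) ((1 + p - q) / 2 + α) (1 + p) (1 - (x : ℂ))

/-- The Jacobi operator `D_{p,q}` acting on functions on `(0,1)`. -/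
def jacobiOp (p q : ℂ) (f : ℝ → ℂ) (x : ℝ) : ℂ :=
  -(p + q + (1 - q) * (x : ℂ)) * (x : ℂ) * deriv f x
    + (1 - (x : ℂ)) * (x : ℂ) ^ 2 * deriv (deriv f) x

/-- A power series converging on the open unit disc is differentiated termwise there, and the
derived series also converges on that disc. -/
theorem summable_and_hasDerivAt_tsum_pow {u : ℕ → ℂ}
    (hu : ∀ z : ℂ, ‖z‖ < 1 → Summable fun n => u n * z ^ n) {z : ℂ} (hz : ‖z‖ < 1) :
    (Summable fun n : ℕ => (n + 1) * u (n + 1) * z ^ n) ∧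
      HasDerivAt (fun w => ∑' n, u n * w ^ n) (∑' n : ℕ, (n + 1) * u (n + 1) * z ^ n) z := by
  obtain ⟨r, hzr, hr1⟩ := exists_between hz
  obtain ⟨R, hrR, hR1⟩ := exists_between hr1
  have hr0 : 0 < r := (norm_nonneg z).trans_lt hzr
  have hR0 : 0 < R := hr0.trans hrR
  have hRs := hu (R : ℂ) (by simpa [abs_of_pos hR0] using hR1)
  obtain ⟨C, hC⟩ : ∃ C, ∀ n, ‖u n * (R : ℂ) ^ n‖ ≤ C := by
    obtain ⟨C, hC⟩ := hRs.tendsto_atTop_zero.norm.bddAbove_range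
    exact ⟨C, fun n => hC ⟨n, rfl⟩⟩
  have hq : r / R < 1 := (div_lt_one hR0).2 hrR
  have hgeo : Summable fun n : ℕ => C / R * ((n + 1 : ℝ) * (r / R) ^ n) := by
    have hnorm : ‖r / R‖ < 1 := by
      rwa [Real.norm_of_nonneg (by positivity)]
    refine Summable.mul_left _ ?_
    have h1 := (summable_pow_mul_geometric_of_norm_lt_one 1 hnorm).add
      (summable_geometric_of_norm_lt_one hnorm)
    refine h1.congr fun n => ?_
    ring
  have hbound : ∀ (n : ℕ) (w : ℂ), ‖w‖ < r →
      ‖(n + 1) * u (n + 1) * w ^ n‖ ≤ C / R * ((n + 1 : ℝ) * (r / R) ^ n) := by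
    intro n w hw
    have h1 : ‖u (n + 1)‖ * R ^ (n + 1) ≤ C := by
      simpa [abs_of_pos hR0] using hC (n + 1)
    have h2 : ‖u (n + 1)‖ ≤ C / R ^ (n + 1) := (le_div_iff₀ (by positivity)).2 h1
    have h3 : ‖(n + 1 : ℂ)‖ = n + 1 := by
      exact_mod_cast Complex.norm_natCast (n + 1)
    have hC0 : 0 ≤ C := (norm_nonneg _).trans (hC 0)
    rw [norm_mul, norm_mul, norm_pow, h3]
    calc (n + 1 : ℝ) * ‖u (n + 1)‖ * ‖w‖ ^ n
        ≤ (n + 1 : ℝ) * (C / R ^ (n + 1)) * r ^ n := by gcongr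
      _ = C / R * ((n + 1 : ℝ) * (r / R) ^ n) := by
        rw [div_pow, pow_succ]; field_simp
  refine ⟨Summable.of_norm_bounded hgeo fun n => hbound n z hzr, ?_⟩
  have hd := hasDerivAt_tsum_of_isPreconnected (𝕜 := ℂ) (F := ℂ) hgeo
    (g := fun n w => u (n + 1) * w ^ (n + 1))
    (g' := fun n w => (n + 1) * u (n + 1) * w ^ n)
    (t := Metric.ball (0 : ℂ) r) (y₀ := 0) (y := z)
    Metric.isOpen_ball (convex_ball _ _).isPreconnected
    (fun n w _ => by
      refine ((hasDerivAt_pow (n + 1) w).const_mul (u (n + 1))).congr_deriv ?_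
      push_cast
      ring)
    (fun n w hw => hbound n w (by simpa using hw))
    (by simpa using hr0) (by simp) (by simpa using hzr)
  refine (hd.const_add (u 0)).congr_of_eventuallyEq ?_
  filter_upwards [Metric.isOpen_ball.mem_nhds (by simpa using hz : z ∈ Metric.ball (0 : ℂ) 1)]
    with w hw
  rw [(hu w (by simpa using hw)).tsum_eq_zero_add]
  simp

/-- The coefficients of the Gauss hypergeometric series. -/
def hypCoeff (a b c : ℂ) (n : ℕ) : ℂ := poch a n * poch b n / (poch c n * (n.factorial : ℂ))

theorem hypCoeff_succ {a b c : ℂ} (hc : ∀ n : ℕ, c + n ≠ 0) (n : ℕ) :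
    (c + n) * ((n + 1) * hypCoeff a b c (n + 1)) = (a + n) * (b + n) * hypCoeff a b c n := by
  have hp : ∀ k, poch c k ≠ 0 := by
    intro k
    induction k with
    | zero => simp [poch]
    | succ k ih =>
      have : poch c (k + 1) = poch c k * (c + k) := ascPochhammer_succ_eval k c
      rw [this]
      exact mul_ne_zero ih (hc k)
  have h1 : ∀ d, poch d (n + 1) = poch d n * (d + n) := fun d => ascPochhammer_succ_eval n d
  have h2 := hp n
  have h3 := hc n
  have h4 : (n.factorial : ℂ) ≠ 0 := by exact_mod_cast n.factorial_ne_zero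
  have h5 : (n + 1 : ℂ) ≠ 0 := by exact_mod_cast n.succ_ne_zero
  simp only [hypCoeff, h1, Nat.factorial_succ]
  push_cast
  field_simp

theorem summable_hypCoeff {a b c : ℂ} (hc : ∀ n : ℕ, c + n ≠ 0) {z : ℂ} (hz : ‖z‖ < 1) :
    Summable fun n => hypCoeff a b c n * z ^ n := by
  have hlim : ∀ d : ℂ, Filter.Tendsto (fun n : ℕ => d / n + 1) Filter.atTop (nhds 1) := by
    intro d
    simpa using (tendsto_const_div_atTop_nhds_zero_nat d).add_const 1
  have ht : Filter.Tendsto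
      (fun n : ℕ => ‖(a + n) * (b + n) / ((c + n) * (1 + n)) * z‖) Filter.atTop (nhds ‖z‖) := by
    have h := ((((hlim a).mul (hlim b)).div ((hlim c).mul (hlim 1)) (by simp)).mul_const z).norm
    simp only [mul_one, div_one, one_mul] at h
    refine h.congr' ?_
    filter_upwards [Filter.eventually_ne_atTop 0] with n hn
    have hn' : (n : ℂ) ≠ 0 := by exact_mod_cast hn
    have h5 : (1 + n : ℂ) ≠ 0 := by rw [add_comm]; exact_mod_cast n.succ_ne_zero
    have h3 := hc n
    have e : ∀ d : ℂ, d / n + 1 = (d + n) / n := fun d => by field_simp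
    simp only [Pi.div_apply, e]
    congr 2
    field_simp
  obtain ⟨r, hzr, hr1⟩ := exists_between hz
  refine summable_of_ratio_norm_eventually_le hr1 ?_
  filter_upwards [ht.eventually_le_const hzr] with n hn
  have h5 : (1 + n : ℂ) ≠ 0 := by rw [add_comm]; exact_mod_cast n.succ_ne_zero
  have h3 := hc n
  have e : hypCoeff a b c (n + 1) * z ^ (n + 1)
      = (a + n) * (b + n) / ((c + n) * (1 + n)) * z * (hypCoeff a b c n * z ^ n) := by
    have h := hypCoeff_succ (a := a) (b := b) hc n
    field_simp
    linear_combination z ^ (n + 1) * h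
  rw [e, norm_mul]
  gcongr

/-- The Gauss hypergeometric differential equation on the unit disc. -/
theorem hyp2F1_ode {a b c : ℂ} (hc : ∀ n : ℕ, c + n ≠ 0) :
    ∃ f₁ f₂ : ℂ → ℂ, ∀ z : ℂ, ‖z‖ < 1 →
      HasDerivAt (hyp2F1 a b c) (f₁ z) z ∧ HasDerivAt f₁ (f₂ z) z ∧
      z * (1 - z) * f₂ z + (c - (a + b + 1) * z) * f₁ z - a * b * hyp2F1 a b c z = 0 := by
  set u := hypCoeff a b c with hu
  set v : ℕ → ℂ := fun n => (n + 1) * u (n + 1) with hv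
  have hsu : ∀ z : ℂ, ‖z‖ < 1 → Summable fun n => u n * z ^ n :=
    fun z hz => summable_hypCoeff hc hz
  have hsv : ∀ z : ℂ, ‖z‖ < 1 → Summable fun n => v n * z ^ n :=
    fun z hz => (summable_and_hasDerivAt_tsum_pow hsu hz).1
  refine ⟨fun z => ∑' n, v n * z ^ n, fun z => ∑' n : ℕ, (n + 1) * v (n + 1) * z ^ n,
    fun z hz => ⟨(summable_and_hasDerivAt_tsum_pow hsu hz).2,
      (summable_and_hasDerivAt_tsum_pow hsv hz).2, ?_⟩⟩
  have shift : ∀ w : ℕ → ℂ, (Summable fun n : ℕ => (n + 1) * w (n + 1) * z ^ n) →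
      HasSum (fun n : ℕ => n * w n * z ^ n) (z * ∑' n : ℕ, (n + 1) * w (n + 1) * z ^ n) := by
    intro w hw
    have h := hw.hasSum.mul_left z
    rw [← hasSum_nat_add_iff' 1]
    simp only [Finset.sum_range_one, Nat.cast_zero, zero_mul, sub_zero]
    refine h.congr_fun fun n => ?_
    push_cast
    ring
  have hf : HasSum (fun n => u n * z ^ n) (hyp2F1 a b c z) := (hsu z hz).hasSum
  have hf₁ := (hsv z hz).hasSum
  have hw := (summable_and_hasDerivAt_tsum_pow hsv hz).1
  have hzf₁ := shift u (hsv z hz)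
  have hzf₂ := shift v hw
  have hzzf₂ : HasSum (fun n : ℕ => n * ((n - 1) * u n) * z ^ n)
      (z * (z * ∑' n : ℕ, (n + 1) * v (n + 1) * z ^ n)) := by
    have e : ∀ n : ℕ, (n + 1 : ℂ) * ((((n + 1 : ℕ) : ℂ) - 1) * u (n + 1)) * z ^ n
        = n * v n * z ^ n := by
      intro n
      simp only [hv]
      push_cast
      ring
    have h := shift (fun n => (n - 1) * u n) (by simpa only [e] using hzf₂.summable)
    simpa only [e, hzf₂.tsum_eq] using h
  have htot := (((hzf₂.sub hzzf₂).add (hf₁.mul_left c)).sub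
    (hzf₁.mul_left (a + b + 1))).sub (hf.mul_left (a * b))
  have hzero : HasSum (fun _ : ℕ => (0 : ℂ)) 0 := hasSum_zero
  have key := htot.unique (hzero.congr_fun fun n => by
    have h := hypCoeff_succ (a := a) (b := b) hc n
    simp only [hv]
    linear_combination z ^ n * h)
  linear_combination key

theorem hasDerivAt_cpow_mul_one_sub_cpow_mul (s r : ℂ) {h : ℂ → ℂ} {h' w : ℂ}
    (hw : w ∈ slitPlane) (hw' : 1 - w ∈ slitPlane) (hh : HasDerivAt h h' w) :
    HasDerivAt (fun w => w ^ s * (1 - w) ^ r * h w)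
      (w ^ s * (1 - w) ^ r * ((s / w - r / (1 - w)) * h w + h')) w := by
  have h1 := (hasDerivAt_id w).cpow_const (c := s) hw
  have h2 := ((hasDerivAt_id w).const_sub 1).cpow_const (c := r) hw'
  have h0 := slitPlane_ne_zero hw
  have h0' := slitPlane_ne_zero hw'
  refine ((h1.mul h2).mul hh).congr_deriv ?_
  simp only [id, Pi.mul_apply, cpow_sub _ _ h0, cpow_sub _ _ h0', cpow_one]
  field_simp
  ring

theorem ofReal_div_one_sub_cpow {x : ℝ} (hx : x ∈ Ioo (0 : ℝ) 1) (p : ℝ) :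
    ((x / (1 - x) : ℝ) : ℂ) ^ (p : ℂ) = (x : ℂ) ^ (p : ℂ) * (1 - (x : ℂ)) ^ (-(p : ℂ)) := by
  have h1 : 0 ≤ 1 - x := by linarith [hx.2]
  have e : (1 - (x : ℂ)) = ((1 - x : ℝ) : ℂ) := by push_cast; rfl
  rw [e, ← ofReal_neg, ← ofReal_cpow (div_nonneg hx.1.le h1), ← ofReal_cpow hx.1.le,
    ← ofReal_cpow h1, Real.div_rpow hx.1.le h1, Real.rpow_neg h1, div_eq_mul_inv, ofReal_mul]

theorem stmt5 (p : ℝ) (hp : p < 1) (q α : ℂ) (F : ℝ → ℂ)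
    (hF : F = fun x : ℝ => ((x / (1 - x) : ℝ) : ℂ) ^ ((p : ℝ) : ℂ) * thetaJ (-(p : ℂ)) q α x) :
    ∀ x ∈ Ioo (0 : ℝ) 1,
      DifferentiableAt ℝ F x ∧ DifferentiableAt ℝ (deriv F) x ∧
      jacobiOp (p : ℂ) q F x = (α ^ 2 - (1 + (p : ℂ) + q) ^ 2 / 4) * F x := by
  have hc : ∀ n : ℕ, (1 + -(p : ℂ)) + n ≠ 0 := by
    intro n h
    have h' : 1 + -p + (n : ℝ) = 0 := by exact_mod_cast h
    have : (0 : ℝ) ≤ n := n.cast_nonneg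
    linarith
  obtain ⟨f₁, f₂, hode⟩ := hyp2F1_ode (a := (1 + -(p : ℂ) + q) / 2 + α)
    (b := (1 + -(p : ℂ) - q) / 2 + α) hc
  set f := hyp2F1 ((1 + -(p : ℂ) + q) / 2 + α) ((1 + -(p : ℂ) - q) / 2 + α) (1 + -(p : ℂ)) with hf
  obtain ⟨s, hs⟩ : ∃ s : ℂ, s = (1 + (p : ℂ) + q) / 2 + α := ⟨_, rfl⟩
  set h₁ : ℂ → ℂ := fun w => (s / w - -(p : ℂ) / (1 - w)) * f (1 - w) + -f₁ (1 - w) with hh₁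
  have hFeq : ∀ y ∈ Ioo (0 : ℝ) 1,
      F y = (y : ℂ) ^ s * (1 - (y : ℂ)) ^ (-(p : ℂ)) * f (1 - (y : ℂ)) := by
    intro y hy
    have hy0 : (y : ℂ) ≠ 0 := by exact_mod_cast hy.1.ne'
    have e : s = p + ((1 + -(p : ℂ) + q) / 2 + α) := by rw [hs]; ring
    rw [hF, e, cpow_add _ _ hy0]
    simp only [ofReal_div_one_sub_cpow hy, thetaJ, ← hf]
    ring
  have hslit : ∀ y ∈ Ioo (0 : ℝ) 1, (y : ℂ) ∈ slitPlane ∧ 1 - (y : ℂ) ∈ slitPlane ∧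
      ‖1 - (y : ℂ)‖ < 1 := by
    intro y hy
    have e : (1 - (y : ℂ)) = ((1 - y : ℝ) : ℂ) := by push_cast; rfl
    have h1 : 0 < 1 - y := by linarith [hy.2]
    refine ⟨ofReal_mem_slitPlane.2 hy.1, ?_, ?_⟩
    · rw [e]
      exact ofReal_mem_slitPlane.2 h1
    · rw [e, norm_real, Real.norm_of_nonneg h1.le]
      linarith [hy.1]
  have hflip : ∀ {g : ℂ → ℂ} {g' : ℂ} {w : ℂ}, HasDerivAt g g' (1 - w) →
      HasDerivAt (fun w => g (1 - w)) (-g') w := by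
    intro g g' w hg
    simpa using hg.comp_const_sub 1 w
  have hF' : ∀ y ∈ Ioo (0 : ℝ) 1,
      HasDerivAt F ((y : ℂ) ^ s * (1 - (y : ℂ)) ^ (-(p : ℂ)) * h₁ y) y := by
    intro y hy
    obtain ⟨hy1, hy2, hy3⟩ := hslit y hy
    refine (hasDerivAt_cpow_mul_one_sub_cpow_mul s (-(p : ℂ)) hy1 hy2
      (hflip (hode _ hy3).1)).comp_ofReal.congr_of_eventuallyEq ?_
    filter_upwards [isOpen_Ioo.mem_nhds hy] with t ht using hFeq t ht
  intro x hx
  obtain ⟨hx1, hx2, hx3⟩ := hslit x hx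
  obtain ⟨hd1, hd2, hE⟩ := hode _ hx3
  have hx0 := slitPlane_ne_zero hx1
  have hx0' := slitPlane_ne_zero hx2
  have hcoef : HasDerivAt (fun w : ℂ => s / w - -(p : ℂ) / (1 - w))
      (-s / (x : ℂ) ^ 2 + p / (1 - (x : ℂ)) ^ 2) x := by
    have h1 := (hasDerivAt_const (x : ℂ) s).div (hasDerivAt_id (x : ℂ)) hx0
    have h2 := (hasDerivAt_const (x : ℂ) (-(p : ℂ))).div
      ((hasDerivAt_id (x : ℂ)).const_sub 1) hx0'
    refine (h1.sub h2).congr_deriv ?_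
    simp only [id]
    ring
  have hh₁' := (hcoef.mul (hflip hd1)).add (hflip hd2).neg
  have hF'' := (hasDerivAt_cpow_mul_one_sub_cpow_mul s (-(p : ℂ)) hx1 hx2
    (h := h₁) hh₁').comp_ofReal
  have hdF : HasDerivAt (deriv F) _ x := hF''.congr_of_eventuallyEq (by
    filter_upwards [isOpen_Ioo.mem_nhds hx] with t ht using (hF' t ht).deriv)
  refine ⟨(hF' x hx).differentiableAt, hdF.differentiableAt, ?_⟩
  rw [jacobiOp, (hF' x hx).deriv, hdF.deriv, hFeq x hx]
  simp only [hh₁]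
  generalize (x : ℂ) ^ s * (1 - (x : ℂ)) ^ (-(p : ℂ)) = P
  generalize f₂ (1 - (x : ℂ)) = y₂ at hE ⊢
  generalize f₁ (1 - (x : ℂ)) = y₁ at hE ⊢
  generalize f (1 - (x : ℂ)) = y₀ at hE ⊢
  subst hs
  refine sub_eq_zero.1 (Eq.trans ?_ (mul_eq_zero_of_right (P * x) hE))
  field_simp
  ring
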